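/- If a ∈ α satisfies a ≠ τ(a), then for any indices l₁ < l₂ and m₁ < m₂ in {1,…,k}, the étale phrases P^{1,1;l₁,l₂}_a and P^{1,1;m₁,m₂}_{τ(a)} are not homotopic. -/

import Mathlib

namespace Nano

variable {α : Type*}

/-- A letter: an identifier together with its projection to the alphabet `α`. -/
abbrev Letter (α : Type*) := ℕ × α

/-- The projection of a letter. -/
def proj (A : Letter α) : α := A.2

/-- A phrase: a finite sequence of words, each word a list of letters. -/
abbrev Phrase (α : Type*) := List (List (Letter α))

/-- Flatten a phrase into one list, separating components by `none` (the `|` character). -/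
def flat (P : Phrase α) : List (Option (Letter α)) :=
  List.intercalate [none] (P.map fun w => w.map some)

/-- The `i`-th component (word) of a phrase (0-indexed). -/
def comp (P : Phrase α) (i : ℕ) : List (Letter α) := P.getD i []

/-- A phrase is a Gauss phrase if every letter occurring in it occurs exactly twice. -/
def IsGauss [DecidableEq α] (P : Phrase α) : Prop :=
  ∀ A ∈ P.flatten, P.flatten.count A = 2

/-- All letters of `P` project into the subset `β` of `α`. -/
def ProjIn (β : Set α) (P : Phrase α) : Prop := ∀ A ∈ P.flatten, A.2 ∈ β

/-- Renaming of letters (injective renamings give isomorphisms of `α`-alphabets,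
preserving the projection). -/
def rename (f : ℕ → ℕ) (P : Phrase α) : Phrase α :=
  P.map (List.map fun A => (f A.1, A.2))

/-- One elementary step: an isomorphism or one of the homotopy moves (1)-(3),
for the involution `τ` on `α`. -/
inductive Move (τ : α → α) : Phrase α → Phrase α → Prop
  | iso (f : ℕ → ℕ) (hf : Function.Injective f) (P : Phrase α) :
      Move τ P (rename f P)
  | h1 (P Q : Phrase α) (A : Letter α) (x y : List (Option (Letter α)))
      (hP : flat P = x ++ [some A, some A] ++ y)
      (hQ : flat Q = x ++ y) : Move τ P Q
  | h2 (P Q : Phrase α) (A B : Letter α) (x y z : List (Option (Letter α)))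
      (hAB : B.2 = τ A.2)
      (hP : flat P = x ++ [some A, some B] ++ y ++ [some B, some A] ++ z)
      (hQ : flat Q = x ++ y ++ z) : Move τ P Q
  | h3 (P Q : Phrase α) (A B C : Letter α) (x y z t : List (Option (Letter α)))
      (hAB : A.2 = B.2) (hBC : B.2 = C.2)
      (hP : flat P = x ++ [some A, some B] ++ y ++ [some A, some C] ++ z
              ++ [some B, some C] ++ t)
      (hQ : flat Q = x ++ [some B, some A] ++ y ++ [some C, some A] ++ z
              ++ [some C, some B] ++ t) : Move τ P Q

/-- A nanophrase over the subset `β`: a Gauss phrase all of whose letters project into `β`. -/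
def NanoIn [DecidableEq α] (β : Set α) (P : Phrase α) : Prop := IsGauss P ∧ ProjIn β P

/-- Homotopy of nanophrases in the class of nanophrases over `β ⊆ α`:
a finite chain of isomorphisms, moves (1)-(3) and their inverses, all whose
terms are nanophrases over `β`. -/
def HomotopicIn [DecidableEq α] (τ : α → α) (β : Set α) (P Q : Phrase α) : Prop :=
  Relation.ReflTransGen
    (fun X Y => (Move τ X Y ∨ Move τ Y X) ∧ NanoIn β X ∧ NanoIn β Y) P Q

/-- Homotopy of nanophrases over `α`. -/
def Homotopic [DecidableEq α] (τ : α → α) (P Q : Phrase α) : Prop :=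
  HomotopicIn τ Set.univ P Q

/-! ### Desingularization -/

/-- The letter `A_{p,q}` of the desingularized alphabet. -/
def dLetter (A : Letter α) (p q : ℕ) : Letter α := (Nat.pair A.1 (Nat.pair p q), A.2)

/-- The replacement of the `i`-th occurrence (1-indexed) of a letter `A` of
multiplicity `m`: `A_{1,i} A_{2,i} ⋯ A_{i-1,i} A_{i,i+1} ⋯ A_{i,m}`. -/
def repl (A : Letter α) (i m : ℕ) : List (Letter α) :=
  ((List.range (i - 1)).map fun j => dLetter A (j + 1) i) ++
  ((List.range (m - i)).map fun j => dLetter A i (i + j + 1))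

def desingWord [DecidableEq α] (m : Letter α → ℕ) :
    List (Letter α) → (Letter α → ℕ) → List (Letter α)
  | [], _ => []
  | A :: rest, seen =>
      repl A (seen A + 1) (m A) ++
        desingWord m rest (fun B => if B = A then seen B + 1 else seen B)

def desingAux [DecidableEq α] (m : Letter α → ℕ) :
    Phrase α → (Letter α → ℕ) → Phrase α
  | [], _ => []
  | w :: ws, seen => desingWord m w seen :: desingAux m ws (fun B => seen B + w.count B)

/-- The desingularization `P^d` of an étale phrase `P`. -/
def desing [DecidableEq α] (P : Phrase α) : Phrase α :=
  desingAux (fun A => P.flatten.count A) P (fun _ => 0)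

/-- Homotopy of étale phrases: homotopy of their desingularizations. -/
def EHomotopic [DecidableEq α] (τ : α → α) (P Q : Phrase α) : Prop :=
  Homotopic τ (desing P) (desing Q)

/-! ### Phrases over `α` itself, via the identity projection -/

/-- An element of `α` regarded as a letter (identity projection). -/
def ofα (a : α) : Letter α := (0, a)

/-- The empty phrase `(∅)_k` of length `k`. -/
def emptyP (k : ℕ) : Phrase α := List.replicate k []

/-- `P^{1,1;l₁,l₂}_a`. -/
def P11 (k : ℕ) (l1 l2 : Fin k) (a : α) : Phrase α :=
  List.ofFn fun i => if i = l1 ∨ i = l2 then [ofα a] else []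

/-- `P^{3;l}_a`. -/
def P3 (k : ℕ) (l : Fin k) (a : α) : Phrase α :=
  List.ofFn fun i => if i = l then [ofα a, ofα a, ofα a] else []

/-- `P^{2,1;l₁,l₂}_a`. -/
def P21 (k : ℕ) (l1 l2 : Fin k) (a : α) : Phrase α :=
  List.ofFn fun i => if i = l1 then [ofα a, ofα a] else if i = l2 then [ofα a] else []

/-- `P^{1,2;l₁,l₂}_a`. -/
def P12 (k : ℕ) (l1 l2 : Fin k) (a : α) : Phrase α :=
  List.ofFn fun i => if i = l1 then [ofα a] else if i = l2 then [ofα a, ofα a] else []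

/-- `P^{1,1,1;l₁,l₂,l₃}_a`. -/
def P111 (k : ℕ) (l1 l2 l3 : Fin k) (a : α) : Phrase α :=
  List.ofFn fun i => if i = l1 ∨ i = l2 ∨ i = l3 then [ofα a] else []


/-- The positions of the letter `A` relative to the separators: `true` for each separator and
`false` for each occurrence of `A`. -/
def pattern [DecidableEq α] (A : Letter α) (L : List (Option (Letter α))) : List Bool :=
  L.filterMap fun o => o.elim (some true) fun B => if B = A then some false else none

/-- `1` if `false` occurs but never twice in a row, and `0` otherwise. For the pattern of a letter
of a Gauss phrase, this says that its two occurrences lie in different components. -/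
def crossing (p : List Bool) : ℤ := if false ∈ p ∧ ¬ [false, false] <:+: p then 1 else 0

/-- The signed indicator of `a` and `τ a`. -/
def sign [DecidableEq α] (τ : α → α) (a c : α) : ℤ :=
  (if c = a then 1 else 0) - (if c = τ a then 1 else 0)

/-- The contribution of the letter `A` to the total linking number. -/
def weight [DecidableEq α] (τ : α → α) (a : α) (L : List (Option (Letter α))) (A : Letter α) : ℤ :=
  sign τ a A.2 * crossing (pattern A L)

/-- The signed number of letters of sign `± a` with occurrences in two different components. -/
noncomputable def linking [DecidableEq α] (τ : α → α) (a : α) (L : List (Option (Letter α))) : ℤ :=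
  ∑ᶠ A, weight τ a L A

lemma reduceOption_map_some {β : Type*} (l : List β) : (l.map some).reduceOption = l := by
  simp [List.reduceOption]

lemma flat_reduceOption (P : Phrase α) : (flat P).reduceOption = P.flatten := by
  unfold flat
  induction P with
  | nil => rfl
  | cons w ws ih =>
    cases ws with
    | nil => simp [reduceOption_map_some]
    | cons v vs =>
      simp only [List.map_cons, List.intercalate_cons_cons, List.reduceOption_append,
        reduceOption_map_some, List.flatten_cons] at ih ⊢
      simp [ih]

lemma flat_cons_cons (w v : List (Letter α)) (P : Phrase α) :
    flat (w :: v :: P) = w.map some ++ none :: flat (v :: P) := by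
  simp [flat, List.intercalate_cons_cons]

lemma flat_rename (f : ℕ → ℕ) (P : Phrase α) :
    flat (rename f P) = (flat P).map (Option.map (Prod.map f id)) := by
  cases P with
  | nil => rfl
  | cons w ws =>
    induction ws generalizing w with
    | nil => simp [flat, rename, Function.comp_def, Prod.map]
    | cons v vs ih =>
      have := ih v
      simp only [rename, List.map_cons, flat_cons_cons] at this ⊢
      simp [this, Function.comp_def, Prod.map]

lemma P11_eq_append {k : ℕ} {l1 l2 : Fin k} (hl : l1 < l2) (a : α) :
    ∃ p q r, P11 k l1 l2 a = List.replicate p [] ++ [ofα a] ::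
      (List.replicate q [] ++ [ofα a] :: List.replicate r []) := by
  have h : l1.1 < l2.1 := hl
  have hk := l2.2
  refine ⟨l1, l2 - l1 - 1, k - l2 - 1, List.ext_getElem ?_ fun i h1 h2 => ?_⟩
  · simp [P11]
    omega
  · simp only [P11, List.getElem_ofFn, List.getElem_append, List.getElem_cons, Fin.ext_iff,
      List.length_replicate, List.getElem_replicate]
    split_ifs <;> first | rfl | omega

section Invariance

variable [DecidableEq α]

@[simp] lemma pattern_nil (A : Letter α) : pattern A [] = [] := rfl

@[simp] lemma pattern_append (A : Letter α) (L M : List (Option (Letter α))) :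
    pattern A (L ++ M) = pattern A L ++ pattern A M := List.filterMap_append

@[simp] lemma pattern_cons_none (A : Letter α) (L : List (Option (Letter α))) :
    pattern A (none :: L) = true :: pattern A L := rfl

lemma pattern_cons_some (A B : Letter α) (L : List (Option (Letter α))) :
    pattern A (some B :: L) = if B = A then false :: pattern A L else pattern A L := by
  unfold pattern
  split_ifs with h <;> simp [h]

lemma false_mem_pattern {A : Letter α} {L : List (Option (Letter α))} :
    false ∈ pattern A L ↔ some A ∈ L := by
  induction L with
  | nil => simp
  | cons o L ih =>
    cases o with
    | none => simp [ih]
    | some B =>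
      rw [pattern_cons_some]
      split_ifs with h <;> simp [h, ih]
      exact fun h' => absurd h'.symm h

lemma pattern_eq_of_notMem {A B : Letter α} {L : List (Option (Letter α))}
    (hA : some A ∉ L) (hB : some B ∉ L) : pattern A L = pattern B L := by
  refine List.filterMap_congr fun o ho => ?_
  cases o with
  | none => rfl
  | some D =>
    have h1 : D ≠ A := by rintro rfl; exact hA ho
    have h2 : D ≠ B := by rintro rfl; exact hB ho
    simp [h1, h2]

lemma crossing_of_notMem {A : Letter α} {L : List (Option (Letter α))} (h : some A ∉ L) :
    crossing (pattern A L) = 0 := by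
  simp [crossing, false_mem_pattern, h]

lemma weight_support_finite (τ : α → α) (a : α) (L : List (Option (Letter α))) :
    (Function.support (weight τ a L)).Finite := by
  refine (L.reduceOption.toFinset.finite_toSet).subset fun A hA => ?_
  by_contra h
  refine hA ?_
  have : some A ∉ L := by simpa [List.reduceOption_mem_iff] using h
  simp [weight, crossing_of_notMem this]

lemma sign_involution {τ : α → α} (hτ : Function.Involutive τ) (a c : α) :
    sign τ a (τ c) = - sign τ a c := by
  have h1 : τ c = a ↔ c = τ a := hτ.eq_iff
  have h2 : τ c = τ a ↔ c = a := hτ.injective.eq_iff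
  simp [sign, h1, h2]

lemma count_flat (P : Phrase α) (A : Letter α) :
    (flat P).count (some A) = P.flatten.count A := by
  rw [← flat_reduceOption]
  induction flat P with
  | nil => rfl
  | cons o L ih =>
    cases o <;> simp [List.count_cons, ih]

lemma IsGauss.count_flat {P : Phrase α} (h : IsGauss P) {A : Letter α} (hA : some A ∈ flat P) :
    (flat P).count (some A) = 2 := by
  rw [Nano.count_flat]
  apply h
  rwa [← flat_reduceOption, List.reduceOption_mem_iff]

lemma pattern_map {g : Letter α → Letter α} (hg : Function.Injective g) (A : Letter α)
    (L : List (Option (Letter α))) : pattern (g A) (L.map (Option.map g)) = pattern A L := by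
  unfold pattern
  rw [List.filterMap_map]
  refine List.filterMap_congr fun o _ => ?_
  cases o <;> simp [hg.eq_iff]

lemma linking_rename (τ : α → α) (a : α) {f : ℕ → ℕ} (hf : Function.Injective f) (P : Phrase α) :
    linking τ a (flat (rename f P)) = linking τ a (flat P) := by
  have hg : Function.Injective (Prod.map f id : Letter α → Letter α) :=
    hf.prodMap Function.injective_id
  rw [flat_rename]
  unfold linking
  calc _ = ∑ᶠ A ∈ Set.range (Prod.map f id : Letter α → Letter α),
        weight τ a ((flat P).map (Option.map (Prod.map f id))) A := by
        rw [← finsum_mem_univ]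
        refine finsum_mem_inter_support_eq _ _ _ ?_
        rw [Set.univ_inter, eq_comm, Set.inter_eq_right]
        intro A hA
        by_contra h
        refine hA ?_
        unfold weight
        rw [crossing_of_notMem, mul_zero]
        intro hm
        obtain ⟨o, -, ho⟩ := List.mem_map.1 hm
        obtain ⟨B, -, hB⟩ := Option.map_eq_some_iff.1 ho
        exact h ⟨B, hB⟩
    _ = _ := by
        rw [finsum_mem_range hg]
        refine finsum_congr fun A => ?_
        rw [weight, pattern_map hg]
        rfl

lemma linking_deletePair {τ : α → α} (hτ : Function.Involutive τ) (a : α) {A B : Letter α}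
    {x y z : List (Option (Letter α))} (hAB : B.2 = τ A.2) (hne : A ≠ B)
    (hA : some A ∉ x ++ y ++ z) (hB : some B ∉ x ++ y ++ z) :
    linking τ a (x ++ [some A, some B] ++ y ++ [some B, some A] ++ z) =
      linking τ a (x ++ y ++ z) := by
  set L := x ++ [some A, some B] ++ y ++ [some B, some A] ++ z with hL
  set M := x ++ y ++ z with hM
  have hwA : weight τ a M A = 0 := by rw [weight, crossing_of_notMem hA, mul_zero]
  have hwB : weight τ a M B = 0 := by rw [weight, crossing_of_notMem hB, mul_zero]
  have hpat : pattern A L = pattern B L := by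
    simp only [hM, List.mem_append, not_or] at hA hB
    simp [hL, pattern_cons_some, hne, hne.symm, pattern_eq_of_notMem hA.1.1 hB.1.1,
      pattern_eq_of_notMem hA.1.2 hB.1.2, pattern_eq_of_notMem hA.2 hB.2]
  have hcancel : weight τ a L B = - weight τ a L A := by
    rw [weight, weight, hpat, hAB, sign_involution hτ, neg_mul]
  have hother : ∀ D, D ≠ A → D ≠ B → weight τ a L D = weight τ a M D := by
    intro D h1 h2
    simp [weight, hL, hM, pattern_cons_some, h1.symm, h2.symm]
  unfold linking
  rw [← sub_eq_zero, ← finsum_sub_distrib (weight_support_finite τ a L)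
    (weight_support_finite τ a M)]
  rw [finsum_eq_sum_of_support_subset (s := {A, B}), Finset.sum_pair hne, hwA, hwB, hcancel]
  · ring
  · intro D hD
    by_contra h
    simp only [Finset.coe_insert, Finset.coe_singleton, Set.mem_insert_iff,
      Set.mem_singleton_iff, not_or] at h
    exact hD (by simp [hother D h.1 h.2])

lemma Move.linking_eq {τ : α → α} (hτ : Function.Involutive τ) (a : α) {P Q : Phrase α}
    (h : Move τ P Q) (hG : IsGauss P) : linking τ a (flat P) = linking τ a (flat Q) := by
  cases h with
  | iso f hf => exact (linking_rename τ a hf P).symm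
  | h1 _ _ A x y hP hQ =>
    have hc := hG.count_flat (A := A) (by simp [hP])
    rw [hP] at hc ⊢
    rw [hQ]
    have hA : some A ∉ x ++ y := by
      rw [← List.count_eq_zero]
      simp only [List.count_append, List.count_cons_self, List.count_nil] at hc ⊢
      omega
    refine finsum_congr fun D => ?_
    unfold weight
    rcases eq_or_ne A D with rfl | hD
    · rw [crossing_of_notMem hA]
      have : [false, false] <:+: pattern A (x ++ [some A, some A] ++ y) :=
        ⟨pattern A x, pattern A y, by simp [pattern_cons_some]⟩
      simp only [crossing, this, not_true, and_false, if_false]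
    · simp [pattern_cons_some, hD]
  | h2 _ _ A B x y z hAB hP hQ =>
    have hcA := hG.count_flat (A := A) (by simp [hP])
    have hcB := hG.count_flat (A := B) (by simp [hP])
    rw [hP] at hcA hcB ⊢
    rw [hQ]
    have hne : A ≠ B := by
      rintro rfl
      simp only [List.count_append, List.count_cons_self, List.count_nil] at hcA
      omega
    refine linking_deletePair hτ a hAB hne ?_ ?_
    · rw [← List.count_eq_zero]
      simp [hne.symm] at hcA ⊢
      omega
    · rw [← List.count_eq_zero]
      simp [hne] at hcB ⊢
      omega
  | h3 _ _ A B C x y z t hAB hBC hP hQ =>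
    rw [hP, hQ]
    refine finsum_congr fun D => ?_
    have : ∀ E F : Letter α, pattern D [some E, some F] = pattern D [some F, some E] := by
      intro E F
      simp only [pattern_cons_some]
      split_ifs <;> rfl
    simp only [weight, pattern_append, this A B, this A C, this B C]

lemma Homotopic.linking_eq {τ : α → α} (hτ : Function.Involutive τ) (a : α) {P Q : Phrase α}
    (h : Homotopic τ P Q) : linking τ a (flat P) = linking τ a (flat Q) := by
  unfold Homotopic HomotopicIn at h
  induction h with
  | refl => rfl
  | tail _ h ih =>
    obtain ⟨hm | hm, hX, hY⟩ := h
    · exact ih.trans (hm.linking_eq hτ a hX.1)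
    · exact ih.trans (hm.linking_eq hτ a hY.1).symm

end Invariance

section Computation

variable [DecidableEq α]

lemma desingAux_replicate_append (m seen : Letter α → ℕ) (n : ℕ) (P : Phrase α) :
    desingAux m (List.replicate n [] ++ P) seen = List.replicate n [] ++ desingAux m P seen := by
  induction n with
  | zero => rfl
  | succ n ih => simpa [List.replicate_succ, desingAux, desingWord] using ih

lemma desing_P11 {k : ℕ} {l1 l2 : Fin k} (hl : l1 < l2) (a : α) :
    ∃ p q r, desing (P11 k l1 l2 a) = List.replicate p [] ++ [dLetter (ofα a) 1 2] ::
      (List.replicate q [] ++ [dLetter (ofα a) 1 2] :: List.replicate r []) := by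
  obtain ⟨p, q, r, h⟩ := P11_eq_append hl a
  refine ⟨p, q, r, ?_⟩
  have hr (m seen : Letter α → ℕ) :
      desingAux m (List.replicate r []) seen = List.replicate r [] := by
    simpa [desingAux] using desingAux_replicate_append m seen r []
  rw [h, desing, desingAux_replicate_append, desingAux, desingAux_replicate_append, desingAux, hr]
  simp [desingWord, repl]

lemma not_infix_pattern_flat {A : Letter α} {P : Phrase α} (h : ∀ w ∈ P, w.count A ≤ 1) :
    ¬ [false, false] <:+: pattern A (flat P) := by
  have hword (w : List (Letter α)) : pattern A (w.map some) = List.replicate (w.count A) false := by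
    induction w with
    | nil => rfl
    | cons B w ih =>
      rw [List.map_cons, pattern_cons_some, ih, List.count_cons]
      by_cases hB : B = A <;> simp [hB, List.replicate_succ]
  induction P with
  | nil => simp [flat]
  | cons w ws ih =>
    have hw : w.count A ≤ 1 := h w (by simp)
    have ih := ih fun v hv => h v (by simp [hv])
    cases ws with
    | nil =>
      simp only [flat, List.map_cons, List.map_nil, List.intercalate_singleton, hword]
      interval_cases w.count A <;> simp [List.infix_cons_iff]
    | cons v vs =>
      rw [flat_cons_cons, pattern_append, pattern_cons_none, hword]
      interval_cases w.count A <;> simp [List.infix_cons_iff, ih]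

lemma linking_desing_P11 (τ : α → α) (a b : α) {k : ℕ} {l1 l2 : Fin k} (hl : l1 < l2) :
    linking τ a (flat (desing (P11 k l1 l2 b))) = sign τ a b := by
  obtain ⟨p, q, r, h⟩ := desing_P11 hl b
  set A := dLetter (ofα b) 1 2
  have hmem (D : Letter α) : some D ∈ flat (desing (P11 k l1 l2 b)) ↔ D = A := by
    rw [← List.reduceOption_mem_iff, flat_reduceOption, h]
    simp
  unfold linking
  rw [finsum_eq_single _ A]
  · have hinf : ¬ [false, false] <:+: pattern A (flat (desing (P11 k l1 l2 b))) := by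
      refine not_infix_pattern_flat fun w hw => ?_
      rw [h] at hw
      simp only [List.mem_append, List.mem_cons, List.mem_replicate] at hw
      rcases hw with ⟨-, rfl⟩ | rfl | ⟨-, rfl⟩ | rfl | ⟨-, rfl⟩ <;> simp
    rw [weight, crossing, if_pos ⟨false_mem_pattern.2 ((hmem A).2 rfl), hinf⟩, mul_one]
    rfl
  · intro D hD
    rw [weight, crossing_of_notMem (mt (hmem D).1 hD), mul_zero]

end Computation

/-- If `a ≠ τ(a)`, then for any indices `l₁ < l₂` and `m₁ < m₂` in `{1,…,k}`
the étale phrases `P^{1,1;l₁,l₂}_a` and `P^{1,1;m₁,m₂}_{τ(a)}` are not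
homotopic. -/
theorem P11_a_not_homotopic_P11_tau_a
    {α : Type*} [Fintype α] [DecidableEq α] (τ : α → α) (hτ : Function.Involutive τ)
    (k : ℕ) (a : α) (ha : a ≠ τ a)
    (l1 l2 m1 m2 : Fin k) (hl : l1 < l2) (hm : m1 < m2) :
    ¬ EHomotopic τ (P11 k l1 l2 a) (P11 k m1 m2 (τ a)) := by
  intro h
  have := Homotopic.linking_eq hτ a h
  rw [linking_desing_P11 τ a a hl, linking_desing_P11 τ a (τ a) hm] at this
  simp [sign, ha, ha.symm] at this

end Nano
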